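/- Let k ∈ ℝ. The scalar Helmholtz Green's function g(y) = exp(−i k ‖y‖)/(4π‖y‖) satisfies the homogeneous Helmholtz equation away from the origin: for every y ≠ 0, g is twice differentiable at y and the Laplacian (the trace of the second derivative, Δg(y) = Σᵢ D²g(y)(eᵢ, eᵢ) over an orthonormal basis) satisfies Δg(y) + k²·g(y) = 0. -/

import Mathlib

open MeasureTheory Metric Real

noncomputable def gHelm (k : ℝ) (y : EuclideanSpace ℝ (Fin 3)) : ℂ :=
  Complex.exp (-Complex.I * k * ‖y‖) / (4 * π * ‖y‖)

section Radial

variable {E : Type*} [NormedAddCommGroup E] [InnerProductSpace ℝ E]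

theorem hasFDerivAt_norm_of_ne_zero {y : E} (hy : y ≠ 0) :
    HasFDerivAt (fun x : E => ‖x‖) (‖y‖⁻¹ • innerSL ℝ y) y := by
  have h := ((hasStrictFDerivAt_norm_sq y).hasFDerivAt).sqrt (by simpa using hy)
  simp only [Real.sqrt_sq (norm_nonneg _)] at h
  convert h using 1
  ext v
  simp
  field_simp

/-- The inner product, as a continuous linear map into complex-valued real linear functionals. -/
noncomputable def complexInnerCLM (E : Type*) [NormedAddCommGroup E] [InnerProductSpace ℝ E] :
    E →L[ℝ] E →L[ℝ] ℂ :=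
  (ContinuousLinearMap.compL ℝ E ℝ ℂ Complex.ofRealCLM).comp (innerSL ℝ)

theorem complexInnerCLM_apply (x v : E) : complexInnerCLM E x v = (inner ℝ x v : ℝ) := rfl

/-- The Fréchet derivative of a radial function `F ‖x‖`, where `F` has derivative `‖y‖ * Φ`
at `‖y‖`. -/
theorem HasDerivAt.hasFDerivAt_comp_norm {F : ℝ → ℂ} {Φ : ℂ} {y : E} (hy : y ≠ 0)
    (hF : HasDerivAt F (‖y‖ * Φ) ‖y‖) :
    HasFDerivAt (fun x : E => F ‖x‖) (Φ • complexInnerCLM E y) y := by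
  have h := hF.hasFDerivAt.comp y (hasFDerivAt_norm_of_ne_zero hy)
  have hr : (‖y‖ : ℂ) ≠ 0 := by simpa using hy
  refine h.congr_fderiv ?_
  ext v
  simp [complexInnerCLM_apply]
  field_simp

/-- The Hessian of a radial function `F ‖x‖`, where `F` has derivative `r * Φ r` and `Φ` has
derivative `‖y‖ * Ψ` at `‖y‖`. -/
theorem hasFDerivAt_fderiv_comp_norm {F Φ : ℝ → ℂ} {Ψ : ℂ} {y : E} (hy : y ≠ 0)
    (hF : ∀ r : ℝ, 0 < r → HasDerivAt F (r * Φ r) r)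
    (hΦ : HasDerivAt Φ (‖y‖ * Ψ) ‖y‖) :
    HasFDerivAt (fderiv ℝ (fun x : E => F ‖x‖))
      (Φ ‖y‖ • complexInnerCLM E +
        (Ψ • complexInnerCLM E y).smulRight (complexInnerCLM E y)) y := by
  have h := (hΦ.hasFDerivAt_comp_norm hy).smul (complexInnerCLM E).hasFDerivAt
  refine h.congr_of_eventuallyEq ?_
  filter_upwards [isOpen_ne.mem_nhds hy] with x hx
  exact ((hF _ (norm_pos_iff.mpr hx)).hasFDerivAt_comp_norm hx).fderiv

theorem sum_fderiv_fderiv_comp_norm {ι : Type*} [Fintype ι] (b : OrthonormalBasis ι ℝ E)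
    {F Φ : ℝ → ℂ} {Ψ : ℂ} {y : E} (hy : y ≠ 0)
    (hF : ∀ r : ℝ, 0 < r → HasDerivAt F (r * Φ r) r)
    (hΦ : HasDerivAt Φ (‖y‖ * Ψ) ‖y‖) :
    ∑ i, fderiv ℝ (fderiv ℝ (fun x : E => F ‖x‖)) y (b i) (b i) =
      Fintype.card ι * Φ ‖y‖ + ‖y‖ ^ 2 * Ψ := by
  have hsum : ∑ i, (inner ℝ y (b i) : ℂ) ^ 2 = (‖y‖ : ℂ) ^ 2 := by
    exact_mod_cast b.sum_sq_inner_left y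
  rw [(hasFDerivAt_fderiv_comp_norm hy hF hΦ).fderiv, ← hsum, Finset.sum_mul]
  simp [complexInnerCLM_apply, Finset.sum_add_distrib]
  exact Finset.sum_congr rfl fun i _ => by ring

end Radial

theorem hasDerivAt_helmholtz_profile (k : ℝ) {r : ℝ} (hr : r ≠ 0) :
    HasDerivAt (fun r : ℝ => Complex.exp (-Complex.I * k * r) / (4 * π * r))
      (Complex.exp (-Complex.I * k * r) / (4 * π * r) * (-Complex.I * k - 1 / r)) r := by
  have hr' : (r : ℂ) ≠ 0 := by exact_mod_cast hr
  have hpi : (π : ℂ) ≠ 0 := by exact_mod_cast Real.pi_ne_zero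
  have hid := (hasDerivAt_id r).ofReal_comp
  have h := ((hid.const_mul (-Complex.I * k)).cexp).div (hid.const_mul (4 * π : ℂ))
    (by simp [hr])
  refine h.congr_deriv ?_
  simp
  field_simp

theorem helmholtz_green_function_equation
    (k : ℝ) (y : EuclideanSpace ℝ (Fin 3)) (hy : y ≠ 0) :
    DifferentiableAt ℝ (gHelm k) y ∧ DifferentiableAt ℝ (fderiv ℝ (gHelm k)) y ∧
      ∀ b : OrthonormalBasis (Fin 3) ℝ (EuclideanSpace ℝ (Fin 3)),
        (∑ i : Fin 3, fderiv ℝ (fderiv ℝ (gHelm k)) y (b i) (b i)) +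
          (k : ℂ) ^ 2 * gHelm k y = 0 := by
  let F : ℝ → ℂ := fun r => Complex.exp (-Complex.I * k * r) / (4 * π * r)
  let Φ : ℝ → ℂ := fun r => F r * ((-Complex.I * k - 1 / r) / r)
  have hF : ∀ r : ℝ, 0 < r → HasDerivAt F (r * Φ r) r := fun r hr => by
    have hr' : (r : ℂ) ≠ 0 := by exact_mod_cast hr.ne'
    convert hasDerivAt_helmholtz_profile k hr.ne' using 1
    simp only [Φ, F]
    field_simp
  have hn : (‖y‖ : ℂ) ≠ 0 := by simpa using hy
  let Ψ : ℂ := -(k ^ 2 * F ‖y‖ + 3 * Φ ‖y‖) / ‖y‖ ^ 2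
  have hΦ : HasDerivAt Φ (‖y‖ * Ψ) ‖y‖ := by
    have hid := (hasDerivAt_id ‖y‖).ofReal_comp
    have h := (hF _ (norm_pos_iff.mpr hy)).mul
      ((((hasDerivAt_const ‖y‖ (1 : ℂ)).div hid hn).const_sub (-Complex.I * k)).div hid hn)
    refine h.congr_deriv ?_
    simp only [Ψ, Φ, id, Complex.ofReal_one, Pi.div_apply]
    field_simp
    linear_combination (F ‖y‖ * k ^ 2 * ‖y‖ ^ 2) * Complex.I_sq
  refine ⟨((hF _ (norm_pos_iff.mpr hy)).hasFDerivAt_comp_norm hy).differentiableAt,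
    (hasFDerivAt_fderiv_comp_norm hy hF hΦ).differentiableAt, fun b => ?_⟩
  change (∑ i, fderiv ℝ (fderiv ℝ (fun x => F ‖x‖)) y (b i) (b i)) + k ^ 2 * F ‖y‖ = 0
  rw [sum_fderiv_fderiv_comp_norm b hy hF hΦ]
  simp only [Ψ, Fintype.card_fin]
  field_simp
  push_cast
  ring
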